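/- arXiv:1904.03300 — 2 statements merged into one kernel-verified Lean document; each statement's English description precedes it below -/
import Mathlib

section
/- Let V be a countable type and let e : V → (V →₀ ℝ) assign to each word w its one-hot vector e(w) = Finsupp.single w 1. For a forgetting factor α ∈ ℝ, define the FOFE code of a finite sequence S = [w₁, …, w_N] of elements of V recursively by z₀ = 0 and z_n = α • z_{n−1} + e(w_n), so that the code of S is z_N = Σ_{n=1}^{N} α^{N−n} • e(w_n). Theorem: if 0 < α ≤ 1/2, then FOFE is unique, i.e., the map sending each finite sequence S : List V to its FOFE code z(S) is injective (any two distinct finite sequences of words, of any finite lengths, have distinct FOFE codes). -/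
/-- The FOFE code of a finite sequence of words, defined by `z₀ = 0` and
`zₙ = α • z_{n-1} + e wₙ`, where `e w = Finsupp.single w 1` is the one-hot
vector of the word `w`. Equivalently, the code of `S = [w₁, …, w_N]` is
`Σ_{n=1}^{N} α^{N-n} • e wₙ`. -/
noncomputable def fofe {V : Type*} (α : ℝ) (S : List V) : V →₀ ℝ :=
  S.foldl (fun z w => α • z + Finsupp.single w 1) 0

theorem fofe_append_singleton {V : Type*} (α : ℝ) (S : List V) (w : V) :
    fofe α (S ++ [w]) = α • fofe α S + Finsupp.single w 1 := by
  simp [fofe]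

theorem fofe_apply_nonneg {V : Type*} {α : ℝ} (hα0 : 0 ≤ α) (S : List V) (v : V) :
    0 ≤ fofe α S v := by
  classical
  induction S using List.reverseRecOn with
  | nil => simp [fofe]
  | append_singleton S w ih =>
    rw [fofe_append_singleton, Finsupp.add_apply, Finsupp.smul_apply, smul_eq_mul,
      Finsupp.single_apply]
    split_ifs <;> positivity

theorem mul_fofe_apply_lt_one {V : Type*} {α : ℝ} (hα0 : 0 < α) (hα : α ≤ 1 / 2)
    (S : List V) (v : V) : α * fofe α S v < 1 := by
  classical
  induction S using List.reverseRecOn with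
  | nil => simp [fofe]
  | append_singleton S w ih =>
    rw [fofe_append_singleton, Finsupp.add_apply, Finsupp.smul_apply, smul_eq_mul,
      Finsupp.single_apply]
    split_ifs <;> nlinarith

theorem one_le_fofe_append_singleton_apply_iff {V : Type*} {α : ℝ} (hα0 : 0 < α)
    (hα : α ≤ 1 / 2) (S : List V) (w v : V) :
    1 ≤ fofe α (S ++ [w]) v ↔ w = v := by
  classical
  have hnonneg := fofe_apply_nonneg hα0.le S v
  have hlt := mul_fofe_apply_lt_one hα0 hα S v
  rw [fofe_append_singleton, Finsupp.add_apply, Finsupp.smul_apply, smul_eq_mul,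
    Finsupp.single_apply]
  split_ifs with h
  · simp only [h, iff_true]
    nlinarith
  · simpa [h] using hlt

theorem fofe_append_singleton_ne_zero {V : Type*} {α : ℝ} (hα0 : 0 < α)
    (hα : α ≤ 1 / 2) (S : List V) (w : V) : fofe α (S ++ [w]) ≠ 0 := by
  intro h
  have hw := (one_le_fofe_append_singleton_apply_iff hα0 hα S w w).2 rfl
  rw [h, Finsupp.zero_apply] at hw
  linarith

/-- If the forgetting factor `α` satisfies `0 < α ≤ 1/2`, then FOFE is unique
for any countable vocabulary `V`: the map sending a finite sequence of words to
its FOFE code is injective. -/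
theorem fofe_injective_of_le_half
    (V : Type*) [Countable V] (α : ℝ) (hα0 : 0 < α) (hα : α ≤ 1 / 2) :
    Function.Injective (fofe (V := V) α) := by
  intro S T h
  induction S using List.reverseRecOn generalizing T with
  | nil =>
    induction T using List.reverseRecOn with
    | nil => rfl
    | append_singleton T u => exact absurd h.symm (fofe_append_singleton_ne_zero hα0 hα T u)
  | append_singleton S w ih =>
    induction T using List.reverseRecOn with
    | nil => exact absurd h (fofe_append_singleton_ne_zero hα0 hα S w)
    | append_singleton T u =>
      obtain rfl : u = w := by
        rw [← one_le_fofe_append_singleton_apply_iff hα0 hα T u w, ← h,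
          one_le_fofe_append_singleton_apply_iff hα0 hα]
      rw [fofe_append_singleton, fofe_append_singleton, add_left_inj] at h
      rw [ih (smul_right_injective _ hα0.ne' h)]
end

section
/- Let V be a countable type and let e : V → (V →₀ ℝ) assign to each word w its one-hot vector e(w) = Finsupp.single w 1. For a forgetting factor α ∈ ℝ, define the FOFE code of a finite sequence S = [w₁, …, w_N] of elements of V by z₀ = 0, z_n = α • z_{n−1} + e(w_n), so that z(S) = Σ_{n=1}^{N} α^{N−n} • e(w_n). Theorem: for every finite N, the set of forgetting factors α in the open interval (1/2, 1) for which the FOFE map S ↦ z(S) fails to be injective on the set of sequences S : List V of length at most N is a countable set (in particular it has Lebesgue measure zero, so FOFE is almost unique everywhere on (1/2, 1), failing only for countably many exceptional choices of α). -/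
open Polynomial in
/-- The integer polynomial whose value at `α` is the `v`-coordinate of the FOFE code of the
reversal of the given list. -/
noncomputable def fofePoly {V : Type*} [DecidableEq V] (v : V) : List V → ℤ[X]
  | [] => 0
  | w :: L => X * fofePoly v L + C (if w = v then 1 else 0)

theorem fofe_reverse_cons {V : Type*} (α : ℝ) (w : V) (L : List V) :
    fofe α (w :: L).reverse = α • fofe α L.reverse + Finsupp.single w 1 := by
  simp [fofe]

theorem aeval_fofePoly {V : Type*} [DecidableEq V] (α : ℝ) (v : V) (L : List V) :
    Polynomial.aeval α (fofePoly v L) = fofe α L.reverse v := by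
  induction L with
  | nil => simp [fofePoly, fofe]
  | cons w L ih =>
    rw [fofe_reverse_cons, fofePoly]
    simp only [map_add, map_mul, Polynomial.aeval_X, ih, Polynomial.aeval_C, Finsupp.add_apply,
      Finsupp.smul_apply, smul_eq_mul, Finsupp.single_apply]
    split_ifs <;> simp

theorem coeff_zero_fofePoly_cons {V : Type*} [DecidableEq V] (v w : V) (L : List V) :
    (fofePoly v (w :: L)).coeff 0 = if w = v then 1 else 0 := by
  split_ifs with h <;> simp [fofePoly, h]

/-- A list is determined by the polynomial coordinates of its code. -/
theorem eq_of_forall_fofePoly_eq {V : Type*} [DecidableEq V] {L M : List V}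
    (h : ∀ v, fofePoly v L = fofePoly v M) : L = M := by
  induction L generalizing M with
  | nil =>
    cases M with
    | nil => rfl
    | cons u M =>
      have h₀ := congrArg (Polynomial.coeff · 0) (h u)
      simp [fofePoly] at h₀
  | cons w L ih =>
    cases M with
    | nil =>
      have h₀ := congrArg (Polynomial.coeff · 0) (h w)
      simp [fofePoly] at h₀
    | cons u M =>
      have h₀ := congrArg (Polynomial.coeff · 0) (h w)
      simp only [coeff_zero_fofePoly_cons, if_true] at h₀
      obtain rfl : u = w := by
        by_contra hne
        simp [hne] at h₀
      rw [ih fun v => ?_]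
      exact mul_left_cancel₀ Polynomial.X_ne_zero (add_right_cancel (h v))

/-- A forgetting factor for which two distinct sequences share a code is algebraic. -/
theorem isAlgebraic_of_fofe_eq {V : Type*} {α : ℝ} {S T : List V} (hne : S ≠ T)
    (h : fofe α S = fofe α T) : IsAlgebraic ℤ α := by
  classical
  obtain ⟨v, hv⟩ : ∃ v, fofePoly v S.reverse ≠ fofePoly v T.reverse := by
    by_contra! hall
    exact hne (List.reverse_injective (eq_of_forall_fofePoly_eq hall))
  refine ⟨fofePoly v S.reverse - fofePoly v T.reverse, sub_ne_zero.mpr hv, ?_⟩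
  simp [aeval_fofePoly, h]

/-- For any countable vocabulary `V` and any finite bound `N` on sequence
lengths, the set of forgetting factors `α ∈ (1/2, 1)` for which FOFE fails to
be injective on sequences of length at most `N` is countable (in particular it
has Lebesgue measure zero): FOFE is almost unique everywhere on `(1/2, 1)`,
except for a countable set of exceptional choices of `α`. -/
theorem fofe_bad_forgetting_factors_countable
    (V : Type*) [Countable V] (N : ℕ) :
    Set.Countable {α : ℝ | α ∈ Set.Ioo (1 / 2 : ℝ) 1 ∧
      ¬ Set.InjOn (fofe (V := V) α) {S : List V | S.length ≤ N}} := by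
  refine (Algebraic.countable ℤ ℝ).mono ?_
  rintro α ⟨-, hα⟩
  simp only [Set.InjOn, not_forall] at hα
  obtain ⟨S, -, T, -, h, hne⟩ := hα
  exact isAlgebraic_of_fofe_eq hne h
end
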